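/- arXiv:2408.09016 — 5 statements merged into one kernel-verified Lean document; each statement's English description precedes it below -/
import Mathlib

section
/- Well-definedness of the comparison maps ϖ (Section 3.6): Let W₁ ⊆ W₂ be subspaces of V and U₁ ⊆ U₂ subspaces of the dual space V*, such that u(w) = 0 for all u ∈ U₂ and all w ∈ W₂. Set uᵢ = dim Uᵢ and let Wᵢ^⊥ = {f ∈ V* : f(w) = 0 for all w ∈ Wᵢ}. Then for every k ∈ ℕ, every nonzero ω₂ ∈ ⋀^{u₂} U₂ and every nonzero ω₁ ∈ ⋀^{u₁} U₁ (all regarded inside the exterior algebra of V*), the subspace (⋀^k W₂^⊥) ∧ ω₂ of ⋀^{k+u₂} V* is contained in the subspace (⋀^{k+u₂−u₁} W₁^⊥) ∧ ω₁. -/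
open Module

/-- For a subspace `S` of a module `E`, `wedgeSpan K S k` is the subspace `⋀^k S` of the
exterior algebra of `E` spanned by `k`-fold wedge products of elements of `S`. -/
noncomputable def wedgeSpan (K : Type*) [Field K] {E : Type*} [AddCommGroup E] [Module K E]
    (S : Submodule K E) (k : ℕ) : Submodule K (ExteriorAlgebra K E) :=
  Submodule.span K
    {x | ∃ f : Fin k → ↥S, x = (List.ofFn fun i => ExteriorAlgebra.ι K (f i : E)).prod}

theorem wedgeSpan_mono {K E : Type*} [Field K] [AddCommGroup E] [Module K E]
    {S T : Submodule K E} (h : S ≤ T) (k : ℕ) : wedgeSpan K S k ≤ wedgeSpan K T k := by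
  refine Submodule.span_mono ?_
  rintro _ ⟨f, rfl⟩
  exact ⟨fun i => ⟨f i, h (f i).2⟩, rfl⟩

theorem prod_ofFn_ι_mem_wedgeSpan {K E : Type*} [Field K] [AddCommGroup E] [Module K E]
    {S : Submodule K E} {k : ℕ} {v : Fin k → E} (hv : ∀ i, v i ∈ S) :
    (List.ofFn fun i => ExteriorAlgebra.ι K (v i)).prod ∈ wedgeSpan K S k :=
  Submodule.subset_span ⟨fun i => ⟨v i, hv i⟩, rfl⟩

theorem prod_ofFn_ι_append {K E : Type*} [Field K] [AddCommGroup E] [Module K E]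
    {k l : ℕ} (v : Fin k → E) (w : Fin l → E) :
    (List.ofFn fun i => ExteriorAlgebra.ι K (Fin.append v w i)).prod =
      (List.ofFn fun i => ExteriorAlgebra.ι K (v i)).prod *
        (List.ofFn fun i => ExteriorAlgebra.ι K (w i)).prod := by
  rw [← List.prod_append, ← List.ofFn_fin_append]
  congr 2
  funext i
  refine Fin.addCases (fun i => ?_) (fun i => ?_) i <;> simp

theorem mul_mem_wedgeSpan {K E : Type*} [Field K] [AddCommGroup E] [Module K E]
    {S : Submodule K E} {k l : ℕ} {x y : ExteriorAlgebra K E}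
    (hx : x ∈ wedgeSpan K S k) (hy : y ∈ wedgeSpan K S l) : x * y ∈ wedgeSpan K S (k + l) := by
  have hxy := Submodule.mul_mem_mul hx hy
  rw [wedgeSpan, wedgeSpan, Submodule.span_mul_span] at hxy
  refine Submodule.span_le.2 ?_ hxy
  rintro _ ⟨_, ⟨f, rfl⟩, _, ⟨g, rfl⟩, rfl⟩
  dsimp only
  rw [← prod_ofFn_ι_append]
  refine prod_ofFn_ι_mem_wedgeSpan fun i => ?_
  refine Fin.addCases (fun i => ?_) (fun i => ?_) i <;> simp

/-- The top exterior power of a subspace is spanned by the wedge product of any basis. -/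
theorem wedgeSpan_le_span_prod_basis {K E : Type*} [Field K] [AddCommGroup E] [Module K E]
    {S : Submodule K E} {n : ℕ} (b : Basis (Fin n) K S) :
    wedgeSpan K S n ≤
      Submodule.span K {(List.ofFn fun i => ExteriorAlgebra.ι K (b i : E)).prod} := by
  let φ : S [⋀^Fin n]→ₗ[K] ExteriorAlgebra K E :=
    (ExteriorAlgebra.ιMulti K n).compLinearMap S.subtype
  have hφ (f : Fin n → S) :
      φ f = (List.ofFn fun i => ExteriorAlgebra.ι K (f i : E)).prod := by
    simp [φ, ExteriorAlgebra.ιMulti_apply]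
  have hdet : φ = (LinearMap.toSpanSingleton K _ (φ b)).compAlternatingMap b.det := by
    refine Basis.ext_alternating b fun v hv => ?_
    let σ : Equiv.Perm (Fin n) := Equiv.ofBijective v (Finite.injective_iff_bijective.1 hv)
    have h₁ : φ (fun i => b (v i)) = Equiv.Perm.sign σ • φ b := φ.map_perm b σ
    have h₂ : b.det (fun i => b (v i)) = Equiv.Perm.sign σ • b.det b := b.det.map_perm b σ
    rw [LinearMap.compAlternatingMap_apply, h₁, h₂, b.det_self]
    simp [Units.smul_def, Int.cast_smul_eq_zsmul]
  refine Submodule.span_le.2 ?_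
  rintro _ ⟨f, rfl⟩
  rw [← hφ, ← hφ, SetLike.mem_coe, Submodule.mem_span_singleton]
  exact ⟨b.det f, (DFunLike.congr_fun hdet f).symm⟩

/-- If `S ≤ T`, the top exterior power of `T` lies in `(⋀^m T) ∧ ω` for every nonzero `ω` in the
top exterior power of `S`, where `m` is the codimension of `S` in `T`. -/
theorem exists_mul_eq_of_mem_wedgeSpan_finrank {K E : Type*} [Field K] [AddCommGroup E]
    [Module K E] [FiniteDimensional K E] {S T : Submodule K E} (h : S ≤ T)
    {ω η : ExteriorAlgebra K E} (hω : ω ∈ wedgeSpan K S (finrank K S)) (hω0 : ω ≠ 0)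
    (hη : η ∈ wedgeSpan K T (finrank K T)) :
    ∃ ζ ∈ wedgeSpan K T (finrank K T - finrank K S), ζ * ω = η := by
  obtain ⟨m, hm⟩ := Nat.exists_eq_add_of_le' (Submodule.finrank_mono h)
  obtain ⟨C, hdis, hsup⟩ := IsModularLattice.exists_disjoint_and_sup_eq h
  have hC : finrank K C = m := by
    have := Submodule.finrank_sup_add_finrank_inf_eq S C
    rw [hdis.eq_bot, hsup, finrank_bot] at this
    omega
  have hCT : C ≤ T := hsup ▸ le_sup_right
  let b := finBasis K S
  let c := finBasisOfFinrankEq K C hC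
  let v : Fin (m + finrank K S) → E := Fin.append (fun i => (c i : E)) (fun i => (b i : E))
  have hv (i) : v i ∈ T := by
    refine Fin.addCases (fun i => ?_) (fun i => ?_) i
    · simpa [v] using hCT (c i).2
    · simpa [v] using h (b i).2
  have span_coe {n : ℕ} {P : Submodule K E} (d : Basis (Fin n) K P) :
      Submodule.span K (Set.range fun i => (d i : E)) = P := by
    have := congrArg (Submodule.map P.subtype) d.span_eq
    rwa [Submodule.map_span, ← Set.range_comp, Submodule.map_top, Submodule.range_subtype] at this
  have hspan : T ≤ Submodule.span K (Set.range v) := by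
    rw [← hsup, sup_le_iff]
    constructor
    · refine (span_coe b).symm.le.trans (Submodule.span_mono ?_)
      rintro _ ⟨i, rfl⟩
      exact ⟨Fin.natAdd m i, by simp [v]⟩
    · refine (span_coe c).symm.le.trans (Submodule.span_mono ?_)
      rintro _ ⟨i, rfl⟩
      exact ⟨Fin.castAdd _ i, by simp [v]⟩
  let v' : Fin (m + finrank K S) → T := fun i => ⟨v i, hv i⟩
  have hspan' : ⊤ ≤ Submodule.span K (Set.range v') := by
    rw [← Submodule.map_le_map_iff_of_injective T.injective_subtype, Submodule.map_top,
      Submodule.range_subtype, Submodule.map_span, ← Set.range_comp]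
    exact hspan
  let d := basisOfTopLeSpanOfCardEqFinrank v' hspan' (by simp [hm])
  have hd (i) : (d i : E) = v i := by simp [d, v']
  rw [hm] at hη
  obtain ⟨a, rfl⟩ := Submodule.mem_span_singleton.1 (wedgeSpan_le_span_prod_basis d hη)
  obtain ⟨e, rfl⟩ := Submodule.mem_span_singleton.1 (wedgeSpan_le_span_prod_basis b hω)
  have he : e ≠ 0 := by
    rintro rfl
    simp at hω0
  rw [hm, Nat.add_sub_cancel]
  refine ⟨(a * e⁻¹) • (List.ofFn fun i => ExteriorAlgebra.ι K (c i : E)).prod,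
    Submodule.smul_mem _ _ (prod_ofFn_ι_mem_wedgeSpan fun i => hCT (c i).2), ?_⟩
  simp only [hd, v, prod_ofFn_ι_append]
  rw [smul_mul_smul_comm, inv_mul_cancel_right₀ he]

/-- **Well-definedness of the comparison maps ϖ** (Section 3.6): let `W₁ ⊆ W₂ ≤ V` and
`U₁ ⊆ U₂ ≤ V*` with `u(w) = 0` for all `u ∈ U₂`, `w ∈ W₂`; set `uᵢ = dim Uᵢ`.  Then for every
`k ∈ ℕ` and nonzero `ω₂ ∈ ⋀^{u₂} U₂`, `ω₁ ∈ ⋀^{u₁} U₁` (inside the exterior algebra of `V*`),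
the subspace `(⋀^k W₂^⊥) ∧ ω₂` of `⋀^{k+u₂} V*` is contained in
`(⋀^{k+u₂−u₁} W₁^⊥) ∧ ω₁`. -/
theorem stmt0 {K V : Type*} [Field K] [AddCommGroup V] [Module K V] [FiniteDimensional K V]
    (W₁ W₂ : Submodule K V) (U₁ U₂ : Submodule K (Module.Dual K V))
    (hW : W₁ ≤ W₂) (hU : U₁ ≤ U₂)
    (horth : ∀ u ∈ U₂, ∀ w ∈ W₂, u w = 0)
    (k : ℕ) (ω₂ : ExteriorAlgebra K (Module.Dual K V))
    (hω₂ : ω₂ ∈ wedgeSpan K U₂ (finrank K ↥U₂)) (hω₂0 : ω₂ ≠ 0)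
    (ω₁ : ExteriorAlgebra K (Module.Dual K V))
    (hω₁ : ω₁ ∈ wedgeSpan K U₁ (finrank K ↥U₁)) (hω₁0 : ω₁ ≠ 0) :
    Submodule.map (LinearMap.mulRight K ω₂) (wedgeSpan K W₂.dualAnnihilator k) ≤
      Submodule.map (LinearMap.mulRight K ω₁)
        (wedgeSpan K W₁.dualAnnihilator (k + finrank K ↥U₂ - finrank K ↥U₁)) := by
  rintro _ ⟨x, hx, rfl⟩
  obtain ⟨ζ, hζ, rfl⟩ := exists_mul_eq_of_mem_wedgeSpan_finrank hU hω₁ hω₁0 hω₂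
  have hW' : W₂.dualAnnihilator ≤ W₁.dualAnnihilator := Submodule.dualAnnihilator_anti hW
  have hU' : U₂ ≤ W₁.dualAnnihilator := fun u hu =>
    hW' ((Submodule.mem_dualAnnihilator u).2 (horth u hu))
  refine ⟨x * ζ, ?_, by simp [mul_assoc]⟩
  rw [Nat.add_sub_assoc (Submodule.finrank_mono hU)]
  exact mul_mem_wedgeSpan (wedgeSpan_mono hW' k hx) (wedgeSpan_mono hU' _ hζ)
end

section
/- Lemma 3.1, contraction form: Let (W,U) be an orthogonal pair in V with w = dim W, u = dim U. Fix nonzero elements Vol(U) ∈ ⋀^u U ⊆ ⋀^u V*, Vol(W) ∈ ⋀^w W ⊆ ⋀^w V and Vol(V) ∈ ⋀^d V. Let ι(Vol(V)) : ⋀^j V* → ⋀^{d−j} V be contraction with Vol(V), i.e. the linear isomorphism characterized by: for α ∈ ⋀^j V*, ι(Vol(V))(α) is the unique element of ⋀^{d−j} V such that β(ι(Vol(V))(α)) = (α ∧ β)(Vol(V)) for all β ∈ ⋀^{d−j} V*, where (·)(·) denotes the canonical pairing of exterior powers of V* with exterior powers of V. Then for every k ∈ ℕ, contraction with Vol(V)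 maps the subspace (⋀^k W^⊥) ∧ Vol(U) of ⋀^{k+u} V* bijectively onto the subspace (⋀^{d−k−u−w} U^⊥) ∧ Vol(W) of ⋀^{d−k−u} V, where W^⊥ = {f ∈ V* : f(W) = 0} and U^⊥ = {v ∈ V : U(v) = 0}. -/
open Module

/-- Integer-indexed version of `wedgeSpan`, with the convention `⋀^k S = 0` for `k < 0`. -/
noncomputable def wedgeSpanZ (K : Type*) [Field K] {E : Type*} [AddCommGroup E] [Module K E]
    (S : Submodule K E) (z : ℤ) : Submodule K (ExteriorAlgebra K E) :=
  if 0 ≤ z then wedgeSpan K S z.toNat else ⊥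

/-- The wedge product of the vectors `b i`, `i ∈ I`, in the order given by `I.toList`. -/
noncomputable def finsetWedge (K : Type*) [Field K] {E ι : Type*} [AddCommGroup E] [Module K E]
    (b : ι → E) (I : Finset ι) : ExteriorAlgebra K E :=
  (I.toList.map fun i => ExteriorAlgebra.ι K (b i)).prod

section FinsetWedge

variable {K E ι : Type*} [Field K] [AddCommGroup E] [Module K E]

theorem exists_unit_smul_of_perm (b : ι → E) {l l' : List ι} (h : l.Perm l') :
    ∃ t : K, t ≠ 0 ∧ (l.map fun i => ExteriorAlgebra.ι K (b i)).prod =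
      t • (l'.map fun i => ExteriorAlgebra.ι K (b i)).prod := by
  induction h with
  | nil => exact ⟨1, one_ne_zero, by simp⟩
  | cons x _ ih =>
    obtain ⟨t, ht, h⟩ := ih
    exact ⟨t, ht, by simp [h]⟩
  | swap x y l =>
    refine ⟨-1, by simp, ?_⟩
    have h := ExteriorAlgebra.ι_add_mul_swap (R := K) (b y) (b x)
    simp only [List.map_cons, List.prod_cons, ← mul_assoc, eq_neg_of_add_eq_zero_left h]
    simp
  | trans _ _ ih₁ ih₂ =>
    obtain ⟨t, ht, h⟩ := ih₁
    obtain ⟨t', ht', h'⟩ := ih₂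
    exact ⟨t * t', mul_ne_zero ht ht', by rw [h, h', smul_smul]⟩

theorem list_wedge_eq_zero_of_not_nodup (b : ι → E) {l : List ι} (h : ¬ l.Nodup) :
    (l.map fun i => ExteriorAlgebra.ι K (b i)).prod = 0 := by
  obtain ⟨x, hx⟩ := List.exists_duplicate_iff_not_nodup.2 h
  obtain ⟨r, hr⟩ := (List.duplicate_iff_sublist.1 hx).exists_perm_append
  obtain ⟨t, -, ht⟩ := exists_unit_smul_of_perm (K := K) b hr
  rw [ht]
  simp [← mul_assoc]

theorem exists_unit_smul_finsetWedge [DecidableEq ι] (b : ι → E) {l : List ι} (h : l.Nodup) :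
    ∃ t : K, t ≠ 0 ∧ (l.map fun i => ExteriorAlgebra.ι K (b i)).prod =
      t • finsetWedge K b l.toFinset :=
  exists_unit_smul_of_perm b (List.toFinset_toList h).symm

theorem finsetWedge_mul_eq_zero (b : ι → E) {I J : Finset ι} (h : ¬ Disjoint I J) :
    finsetWedge K b I * finsetWedge K b J = 0 := by
  rw [finsetWedge, finsetWedge, ← List.prod_append, ← List.map_append]
  refine list_wedge_eq_zero_of_not_nodup b fun hn => h ?_
  rw [Finset.disjoint_left]
  intro a ha hb
  exact (List.disjoint_of_nodup_append hn) (by simpa using ha) (by simpa using hb)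

theorem finsetWedge_mul [DecidableEq ι] (b : ι → E) {I J : Finset ι} (h : Disjoint I J) :
    ∃ t : K, t ≠ 0 ∧
      finsetWedge K b I * finsetWedge K b J = t • finsetWedge K b (I ∪ J) := by
  have hn : (I.toList ++ J.toList).Nodup := by
    refine (Finset.nodup_toList I).append (Finset.nodup_toList J) ?_
    intro a ha hb
    exact Finset.disjoint_left.1 h (by simpa using ha) (by simpa using hb)
  obtain ⟨t, ht, e⟩ := exists_unit_smul_finsetWedge (K := K) b hn
  refine ⟨t, ht, ?_⟩
  rw [List.toFinset_append, Finset.toList_toFinset, Finset.toList_toFinset] at e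
  rw [← e, finsetWedge, finsetWedge, List.map_append, List.prod_append]

theorem span_le_span_of_smul {M : Type*} [AddCommGroup M] [Module K M] {X Y : Set M}
    (h : ∀ x ∈ X, x = 0 ∨ ∃ t : K, ∃ y ∈ Y, x = t • y) :
    Submodule.span K X ≤ Submodule.span K Y := by
  rw [Submodule.span_le]
  intro x hx
  obtain h | ⟨t, y, hy, h⟩ := h x hx
  · rw [h]
    exact zero_mem _
  · rw [h]
    exact Submodule.smul_mem _ _ (Submodule.subset_span hy)

theorem wedgeSpan_eq_pow (S : Submodule K E) (n : ℕ) :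
    wedgeSpan K S n = (S.map (ExteriorAlgebra.ι K)) ^ n := by
  have h : S.map (ExteriorAlgebra.ι K) =
      Submodule.span K (ExteriorAlgebra.ι K '' (S : Set E)) := by
    rw [← Submodule.map_span, Submodule.span_eq]
  rw [h, Submodule.span_pow, wedgeSpan]
  congr 1
  ext x
  rw [Set.mem_pow]
  constructor
  · rintro ⟨f, rfl⟩
    exact ⟨fun i => ⟨_, f i, (f i).2, rfl⟩, rfl⟩
  · rintro ⟨f, rfl⟩
    choose g hg hg' using fun i => (f i).2
    exact ⟨fun i => ⟨g i, hg i⟩, by simp [hg']⟩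

theorem wedgeSpan_span_image [DecidableEq ι] (b : ι → E) (T : Finset ι) (n : ℕ) :
    wedgeSpan K (Submodule.span K (b '' T)) n =
      Submodule.span K {x | ∃ I ⊆ T, I.card = n ∧ x = finsetWedge K b I} := by
  rw [wedgeSpan_eq_pow, Submodule.map_span, Submodule.span_pow]
  apply le_antisymm
  · refine span_le_span_of_smul fun x hx => ?_
    obtain ⟨f, rfl⟩ := Set.mem_pow.1 hx
    choose g hg hg' using fun i => (f i).2
    choose p hp hp' using hg
    have e : (List.ofFn fun i => (f i : ExteriorAlgebra K E)) =
        (List.ofFn p).map fun i => ExteriorAlgebra.ι K (b i) := by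
      rw [List.map_ofFn]
      congr 1
      funext i
      simp [hp', hg']
    rw [e]
    by_cases hn : (List.ofFn p).Nodup
    · obtain ⟨t, -, ht⟩ := exists_unit_smul_finsetWedge (K := K) b hn
      refine Or.inr ⟨t, _, ⟨_, ?_, ?_, rfl⟩, ht⟩
      · intro i hi
        obtain ⟨j, rfl⟩ : ∃ j, p j = i := by simpa [List.mem_ofFn] using hi
        exact hp j
      · rw [List.toFinset_card_of_nodup hn, List.length_ofFn]
    · exact Or.inl (list_wedge_eq_zero_of_not_nodup b hn)
  · refine Submodule.span_mono ?_
    rintro x ⟨I, hI, rfl, rfl⟩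
    have hl : I.toList.length = I.card := Finset.length_toList I
    rw [← hl, Set.mem_pow]
    refine ⟨fun i => ⟨ExteriorAlgebra.ι K (b (I.toList.get i)), _, ⟨_, hI ?_, rfl⟩, rfl⟩, ?_⟩
    · exact Finset.mem_toList.1 (List.get_mem _ _)
    · rw [finsetWedge]
      congr 1
      conv_rhs => rw [← List.ofFn_get I.toList, List.map_ofFn]
      rfl

theorem map_mulRight_wedgeSpan [DecidableEq ι] (b : ι → E) (S T : Finset ι) (n : ℕ)
    {v : ExteriorAlgebra K E} (hv : v ∈ wedgeSpan K (Submodule.span K (b '' T)) T.card)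
    (hv0 : v ≠ 0) (hTS : T ⊆ S) :
    (wedgeSpan K (Submodule.span K (b '' S)) n).map (LinearMap.mulRight K v) =
      Submodule.span K
        {x | ∃ I, T ⊆ I ∧ I ⊆ S ∧ I.card = n + T.card ∧ x = finsetWedge K b I} := by
  have hv' : ∃ t : K, v = t • finsetWedge K b T := by
    rw [wedgeSpan_span_image] at hv
    have hs : v ∈ Submodule.span K {finsetWedge K b T} := by
      refine Submodule.span_mono ?_ hv
      rintro x ⟨I, hI, hc, rfl⟩
      rw [Finset.eq_of_subset_of_card_le hI hc.ge]
      rfl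
    obtain ⟨t, ht⟩ := Submodule.mem_span_singleton.1 hs
    exact ⟨t, ht.symm⟩
  obtain ⟨t, rfl⟩ := hv'
  have ht : t ≠ 0 := by
    rintro rfl
    simp at hv0
  rw [wedgeSpan_span_image, Submodule.map_span]
  apply le_antisymm
  · refine span_le_span_of_smul ?_
    rintro _ ⟨_, ⟨I, hI, hc, rfl⟩, rfl⟩
    rw [LinearMap.mulRight_apply, mul_smul_comm]
    by_cases hd : Disjoint I T
    · obtain ⟨s, -, hs⟩ := finsetWedge_mul (K := K) b hd
      refine Or.inr ⟨t * s, _, ⟨I ∪ T, Finset.subset_union_right, Finset.union_subset hI hTS,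
        ?_, rfl⟩, ?_⟩
      · rw [Finset.card_union_of_disjoint hd, hc]
      · rw [hs, smul_smul]
    · left
      rw [finsetWedge_mul_eq_zero b hd, smul_zero]
  · refine span_le_span_of_smul ?_
    rintro _ ⟨I, hT, hI, hc, rfl⟩
    obtain ⟨s, hs0, hs⟩ := finsetWedge_mul (K := K) b (Finset.sdiff_disjoint (s := T) (t := I))
    rw [Finset.sdiff_union_of_subset hT] at hs
    refine Or.inr ⟨(t * s)⁻¹, _, ⟨_, ⟨I \ T, Finset.sdiff_subset.trans hI, ?_, rfl⟩, rfl⟩, ?_⟩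
    · rw [Finset.card_sdiff_of_subset hT]
      omega
    · rw [LinearMap.mulRight_apply, mul_smul_comm, hs, smul_smul t s, smul_smul,
        inv_mul_cancel₀ (mul_ne_zero ht hs0), one_smul]

theorem eq_sum_pairing_smul {M N : Type*} [AddCommGroup M] [Module K M]
    [AddCommGroup N] [Module K N] (P : M →ₗ[K] N →ₗ[K] K) (s : Finset ι) (x : ι → M) (y : ι → N)
    (h₁ : ∀ i ∈ s, P (x i) (y i) = 1) (h₀ : ∀ i ∈ s, ∀ j ∈ s, i ≠ j → P (x i) (y j) = 0)
    {a : M} (ha : a ∈ Submodule.span K (x '' s)) :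
    a = ∑ i ∈ s, P a (y i) • x i := by
  induction ha using Submodule.span_induction with
  | mem z hz =>
    obtain ⟨i, hi, rfl⟩ := hz
    rw [Finset.sum_eq_single_of_mem i hi, h₁ i hi, one_smul]
    intro j hj hne
    rw [h₀ i hi j hj hne.symm, zero_smul]
  | zero => simp
  | add z z' _ _ h h' =>
    simp only [map_add, LinearMap.add_apply, add_smul, Finset.sum_add_distrib]
    rw [← h, ← h']
  | smul t z _ h =>
    simp only [map_smul, LinearMap.smul_apply, smul_eq_mul, mul_smul, ← Finset.smul_sum]
    rw [← h]

end FinsetWedge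

theorem exists_ofFn_eq_toList {ι : Type*} {n : ℕ} {I : Finset ι} (h : I.card = n) :
    ∃ f : Fin n → ι, List.ofFn f = I.toList := by
  obtain rfl : I.toList.length = n := by rw [Finset.length_toList, h]
  exact ⟨_, List.ofFn_get _⟩

theorem finrank_span_basis_image {K E ι : Type*} [Field K] [AddCommGroup E] [Module K E]
    (b : Basis ι K E) (T : Finset ι) :
    finrank K (Submodule.span K (b '' T)) = T.card := by
  rw [Set.image_eq_range]
  exact (finrank_span_eq_card (b.linearIndependent.comp _ Subtype.val_injective)).trans
    (by simp)

theorem wedgeSpanZ_natCast_sub {K E : Type*} [Field K] [AddCommGroup E] [Module K E]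
    (S : Submodule K E) {m n : ℕ} (h : m ≤ n) :
    wedgeSpanZ K S ((n : ℤ) - m) = wedgeSpan K S (n - m) := by
  rw [wedgeSpanZ, if_pos (by omega)]
  congr 1
  omega

section Dual

variable {K V ι : Type*} [Field K] [AddCommGroup V] [Module K V] [Fintype ι] [DecidableEq ι]

theorem dualAnnihilator_span_image (b : Basis ι K V) (T : Finset ι) :
    (Submodule.span K (b '' T)).dualAnnihilator =
      Submodule.span K (b.dualBasis '' (Tᶜ : Finset ι)) := by
  apply le_antisymm
  · intro f hf
    rw [Submodule.mem_dualAnnihilator] at hf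
    rw [← b.sum_dual_apply_smul_coord f]
    refine Submodule.sum_mem _ fun i _ => ?_
    by_cases hi : i ∈ T
    · rw [hf _ (Submodule.subset_span ⟨i, hi, rfl⟩), zero_smul]
      exact zero_mem _
    · refine Submodule.smul_mem _ _ (Submodule.subset_span ⟨i, by simpa using hi, ?_⟩)
      simp
  · rw [Submodule.span_le]
    rintro _ ⟨i, hi, rfl⟩
    rw [SetLike.mem_coe, Submodule.mem_dualAnnihilator]
    intro w hw
    induction hw using Submodule.span_induction with
    | mem z hz =>
      obtain ⟨j, hj, rfl⟩ := hz
      have hij : j ≠ i := by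
        rintro rfl
        simp at hi hj
        exact hi hj
      simp [Finsupp.single_eq_of_ne, hij.symm]
    | zero => simp
    | add z z' _ _ h h' => rw [map_add, h, h', add_zero]
    | smul t z _ h => rw [map_smul, h, smul_zero]

theorem pairing_finsetWedge_self (b : Basis ι K V)
    (P : ExteriorAlgebra K (Module.Dual K V) →ₗ[K] ExteriorAlgebra K V →ₗ[K] K)
    (hP : ∀ (m : ℕ) (f : Fin m → Module.Dual K V) (v : Fin m → V),
      P ((List.ofFn fun i => ExteriorAlgebra.ι K (f i)).prod)
          ((List.ofFn fun i => ExteriorAlgebra.ι K (v i)).prod) =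
        Matrix.det (Matrix.of fun i j => f i (v j)))
    (I : Finset ι) :
    P (finsetWedge K b.dualBasis I) (finsetWedge K b I) = 1 := by
  obtain ⟨f, hf⟩ := exists_ofFn_eq_toList (I := I) rfl
  have hn : Function.Injective f := List.nodup_ofFn.1 (hf ▸ Finset.nodup_toList I)
  rw [finsetWedge, finsetWedge, ← hf, List.map_ofFn, List.map_ofFn]
  refine (hP _ (fun i => b.dualBasis (f i)) fun i => b (f i)).trans ?_
  refine (congrArg Matrix.det ?_).trans Matrix.det_one
  ext i j
  simp [Matrix.one_apply, Finsupp.single_apply, hn.eq_iff, eq_comm]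

theorem pairing_finsetWedge_of_ne (b : Basis ι K V)
    (P : ExteriorAlgebra K (Module.Dual K V) →ₗ[K] ExteriorAlgebra K V →ₗ[K] K)
    (hP : ∀ (m : ℕ) (f : Fin m → Module.Dual K V) (v : Fin m → V),
      P ((List.ofFn fun i => ExteriorAlgebra.ι K (f i)).prod)
          ((List.ofFn fun i => ExteriorAlgebra.ι K (v i)).prod) =
        Matrix.det (Matrix.of fun i j => f i (v j)))
    {I J : Finset ι} (hIJ : I.card = J.card) (hne : I ≠ J) :
    P (finsetWedge K b.dualBasis I) (finsetWedge K b J) = 0 := by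
  obtain ⟨f, hf⟩ := exists_ofFn_eq_toList hIJ
  obtain ⟨g, hg⟩ := exists_ofFn_eq_toList (I := J) rfl
  obtain ⟨i, hi, hiJ⟩ : ∃ i ∈ I, i ∉ J := by
    by_contra! h
    exact hne (Finset.eq_of_subset_of_card_le h hIJ.ge)
  obtain ⟨p, rfl⟩ : ∃ p, f p = i := by
    rw [← Finset.mem_toList, ← hf] at hi
    simpa [List.mem_ofFn] using hi
  rw [finsetWedge, finsetWedge, ← hf, ← hg, List.map_ofFn, List.map_ofFn]
  refine (hP _ (fun i => b.dualBasis (f i)) fun i => b (g i)).trans ?_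
  refine Matrix.det_eq_zero_of_row_eq_zero p fun q => ?_
  have hq : g q ≠ f p := by
    rintro h
    rw [← h, ← Finset.mem_toList, ← hg] at hiJ
    exact hiJ (List.mem_ofFn.2 ⟨q, rfl⟩)
  simp [Finsupp.single_eq_of_ne, hq.symm]

theorem wedgeSpan_top_eq_span {E : Type*} [AddCommGroup E] [Module K E] (b : Basis ι K E)
    (n : ℕ) :
    wedgeSpan K (⊤ : Submodule K E) n = Submodule.span K
      (finsetWedge K b '' (Finset.univ.powersetCard n : Finset (Finset ι))) := by
  have h := wedgeSpan_span_image (K := K) b Finset.univ n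
  rw [Finset.coe_univ, Set.image_univ, b.span_eq] at h
  rw [h]
  congr 1
  ext x
  simp [Finset.mem_powersetCard, eq_comm]

/-- Contraction with a volume element maps `e*_I` to a nonzero multiple of `e_{Iᶜ}`, and is
injective in each degree. -/
theorem contraction_finsetWedge (b : Basis ι K V)
    (P : ExteriorAlgebra K (Module.Dual K V) →ₗ[K] ExteriorAlgebra K V →ₗ[K] K)
    (hP : ∀ (m : ℕ) (f : Fin m → Module.Dual K V) (v : Fin m → V),
      P ((List.ofFn fun i => ExteriorAlgebra.ι K (f i)).prod)
          ((List.ofFn fun i => ExteriorAlgebra.ι K (v i)).prod) =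
        Matrix.det (Matrix.of fun i j => f i (v j)))
    {v : ExteriorAlgebra K V} (hv : v ∈ wedgeSpan K (⊤ : Submodule K V) (Fintype.card ι))
    (hv0 : v ≠ 0) (m : ℕ)
    (c : ExteriorAlgebra K (Module.Dual K V) →ₗ[K] ExteriorAlgebra K V)
    (hc : ∀ α ∈ wedgeSpan K (⊤ : Submodule K (Module.Dual K V)) m,
      c α ∈ wedgeSpanZ K (⊤ : Submodule K V) ((Fintype.card ι : ℤ) - (m : ℕ)) ∧
        ∀ β ∈ wedgeSpanZ K (⊤ : Submodule K (Module.Dual K V))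
            ((Fintype.card ι : ℤ) - (m : ℕ)),
          P β (c α) = P ((α * β : ExteriorAlgebra K (Module.Dual K V))) v) :
    (∀ I : Finset ι, I.card = m → ∃ t : K, t ≠ 0 ∧
      c (finsetWedge K b.dualBasis I) = t • finsetWedge K b Iᶜ) ∧
    Set.InjOn c (wedgeSpan K (⊤ : Submodule K (Module.Dual K V)) m) := by
  have hmem : ∀ {n : ℕ} {J : Finset ι}, J ∈ Finset.univ.powersetCard n ↔ J.card = n := by
    simp [Finset.mem_powersetCard]
  obtain ⟨μ, rfl⟩ : ∃ μ : K, v = μ • finsetWedge K b Finset.univ := by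
    rw [wedgeSpan_top_eq_span b, ← Finset.card_univ, Finset.powersetCard_self,
      Finset.coe_singleton, Set.image_singleton] at hv
    obtain ⟨μ, h⟩ := Submodule.mem_span_singleton.1 hv
    exact ⟨μ, h.symm⟩
  have hμ : μ ≠ 0 := by
    rintro rfl
    simp at hv0
  have key : ∀ I : Finset ι, I.card = m → ∃ t : K, t ≠ 0 ∧
      c (finsetWedge K b.dualBasis I) = t • finsetWedge K b Iᶜ := by
    intro I hI
    have hle : m ≤ Fintype.card ι := hI ▸ Finset.card_le_univ I
    have hIm : finsetWedge K b.dualBasis I ∈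
        wedgeSpan K (⊤ : Submodule K (Module.Dual K V)) m := by
      rw [wedgeSpan_top_eq_span b.dualBasis]
      exact Submodule.subset_span ⟨I, hmem.2 hI, rfl⟩
    obtain ⟨h₁, h₂⟩ := hc _ hIm
    rw [wedgeSpanZ_natCast_sub _ hle, wedgeSpan_top_eq_span b] at h₁
    rw [wedgeSpanZ_natCast_sub _ hle, wedgeSpan_top_eq_span b.dualBasis] at h₂
    have hIc : Iᶜ.card = Fintype.card ι - m := by rw [Finset.card_compl, hI]
    have hsum := eq_sum_pairing_smul P.flip (Finset.univ.powersetCard (Fintype.card ι - m))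
      (finsetWedge K b) (finsetWedge K b.dualBasis)
      (fun J _ => pairing_finsetWedge_self b P hP J)
      (fun J hJ J' hJ' hne => pairing_finsetWedge_of_ne b P hP
        ((hmem.1 hJ').trans (hmem.1 hJ).symm) hne.symm) h₁
    rw [Finset.sum_eq_single_of_mem Iᶜ (hmem.2 hIc)] at hsum
    · refine ⟨_, ?_, hsum⟩
      obtain ⟨s, hs0, hs⟩ := finsetWedge_mul (K := K) b.dualBasis
        (disjoint_compl_right (a := I))
      rw [LinearMap.flip_apply, h₂ _ (Submodule.subset_span ⟨Iᶜ, hmem.2 hIc, rfl⟩), hs,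
        Finset.union_compl, map_smul, map_smul, LinearMap.smul_apply,
        pairing_finsetWedge_self b P hP]
      simpa using ⟨hμ, hs0⟩
    · intro J hJ hne
      rw [LinearMap.flip_apply, h₂ _ (Submodule.subset_span ⟨J, hJ, rfl⟩),
        finsetWedge_mul_eq_zero, map_zero, LinearMap.zero_apply, zero_smul]
      intro hd
      refine hne (Finset.eq_of_subset_of_card_le ?_ (by rw [hIc, hmem.1 hJ]))
      exact fun i hi => Finset.mem_compl.2 fun h => Finset.disjoint_left.1 hd h hi
  refine ⟨key, ?_⟩
  intro α hα β hβ hαβ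
  rw [← sub_eq_zero]
  have hγ := Submodule.sub_mem _ hα hβ
  have hcγ : c (α - β) = 0 := by rw [map_sub, hαβ, sub_self]
  generalize α - β = γ at hγ hcγ
  rw [wedgeSpan_top_eq_span b.dualBasis] at hγ
  have hsum := eq_sum_pairing_smul P (Finset.univ.powersetCard m)
      (finsetWedge K b.dualBasis) (finsetWedge K b)
      (fun J _ => pairing_finsetWedge_self b P hP J)
      (fun J hJ J' hJ' hne => pairing_finsetWedge_of_ne b P hP
        ((hmem.1 hJ).trans (hmem.1 hJ').symm) hne) hγ
  rw [hsum]
  refine Finset.sum_eq_zero fun J hJ => ?_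
  suffices h : P γ (finsetWedge K b J) = 0 by rw [h, zero_smul]
  have h := congrArg (fun x => P (finsetWedge K b.dualBasis Jᶜ) (c x)) hsum
  simp only [hcγ, map_zero, map_sum, map_smul] at h
  rw [Finset.sum_eq_single_of_mem J hJ] at h
  · obtain ⟨t, ht, e⟩ := key J (hmem.1 hJ)
    rw [e, map_smul, pairing_finsetWedge_self b P hP] at h
    simpa [ht] using h.symm
  · intro J' hJ' hne
    obtain ⟨t, ht, e⟩ := key J' (hmem.1 hJ')
    rw [e, map_smul, pairing_finsetWedge_of_ne b P hP, smul_zero, smul_zero]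
    · rw [Finset.card_compl, Finset.card_compl, hmem.1 hJ, hmem.1 hJ']
    · exact fun h => hne (compl_injective h).symm

end Dual

/-- A basis of `V` adapted to a flag `W ≤ X`. -/
theorem exists_basis_adapted {K V : Type*} [Field K] [AddCommGroup V] [Module K V]
    [FiniteDimensional K V] {W X : Submodule K V} (h : W ≤ X) :
    ∃ (s : Set V) (_ : Fintype s) (b : Basis s K V) (A D : Finset s), A ⊆ D ∧
      W = Submodule.span K (b '' A) ∧ X = Submodule.span K (b '' D) := by
  classical
  obtain ⟨p, hpW, -, hWp, hp⟩ := exists_linearIndepOn_id_extension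
    (linearIndependent_empty K V) (Set.empty_subset (W : Set V))
  obtain ⟨q, hqX, hpq, hXq, hq⟩ := exists_linearIndepOn_id_extension hp
    (hpW.trans (SetLike.coe_subset_coe.2 h))
  obtain ⟨s, -, hqs, hs, hls⟩ := exists_linearIndepOn_id_extension hq (Set.subset_univ q)
  have : Finite s := hls.linearIndependent.finite
  have : Fintype s := Fintype.ofFinite s
  have hsp : ⊤ ≤ Submodule.span K (Set.range fun x : s => id (x : V)) := by
    intro x _
    simpa using hs (Set.mem_univ x)
  have key : ∀ {r : Set V} {Y : Submodule K V}, r ⊆ s → r ⊆ Y → (Y : Set V) ⊆ Submodule.span K r →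
      Y = Submodule.span K (Basis.mk hls hsp ''
        ((Finset.univ.filter fun x : s => (x : V) ∈ r : Finset s) : Set s)) := by
    intro r Y hrs hrY hYr
    have e : Basis.mk hls hsp ''
        ((Finset.univ.filter fun x : s => (x : V) ∈ r : Finset s) : Set s) = r := by
      ext x
      constructor
      · rintro ⟨y, hy, rfl⟩
        simpa using hy
      · intro hx
        exact ⟨⟨x, hrs hx⟩, by simpa using hx, by simp⟩
    rw [e]
    exact le_antisymm hYr (Submodule.span_le.2 hrY)
  refine ⟨s, inferInstance, Basis.mk hls hsp, _, _, ?_, key (hpq.trans hqs) hpW hWp,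
    key hqs hqX hXq⟩
  intro x hx
  simp only [Finset.mem_filter, Finset.mem_univ, true_and] at hx ⊢
  exact hpq hx

set_option synthInstance.maxHeartbeats 1000000 in
/-- **Lemma 3.1, contraction form**: for an orthogonal pair `(W,U)` in a `d`-dimensional
space `V`, with `u = dim U`, `w = dim W`, choose nonzero `Vol(U) ∈ ⋀^u U`,
`Vol(W) ∈ ⋀^w W`, `Vol(V) ∈ ⋀^d V`.  Let `P` be the canonical pairing of exterior powers of
`V*` with those of `V` (given on decomposables by `P(f₁∧⋯∧f_m, v₁∧⋯∧v_m) = det(fᵢ(vⱼ))`),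
and let `c = ι(Vol(V))` be contraction with `Vol(V)`: for `α ∈ ⋀^{k+u} V*`, `c α` is the
element of `⋀^{d−k−u} V` with `P(β, c α) = P(α ∧ β, Vol(V))` for all `β ∈ ⋀^{d−k−u} V*`.
Then `c` maps the subspace `(⋀^k W^⊥) ∧ Vol(U)` of `⋀^{k+u} V*` bijectively onto the
subspace `(⋀^{d−k−u−w} U^⊥) ∧ Vol(W)` of `⋀^{d−k−u} V`. -/
theorem stmt2 {K V : Type*} [Field K] [AddCommGroup V] [Module K V] [FiniteDimensional K V]
    (W : Submodule K V) (U : Submodule K (Module.Dual K V))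
    (horth : ∀ u ∈ U, ∀ w ∈ W, u w = 0)
    (P : ExteriorAlgebra K (Module.Dual K V) →ₗ[K] ExteriorAlgebra K V →ₗ[K] K)
    (hP : ∀ (m : ℕ) (f : Fin m → Module.Dual K V) (v : Fin m → V),
      P ((List.ofFn fun i => ExteriorAlgebra.ι K (f i)).prod)
          ((List.ofFn fun i => ExteriorAlgebra.ι K (v i)).prod) =
        Matrix.det (Matrix.of fun i j => f i (v j)))
    (VolU : ExteriorAlgebra K (Module.Dual K V))
    (hVolU : VolU ∈ wedgeSpan K U (finrank K ↥U)) (hVolU0 : VolU ≠ 0)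
    (VolW : ExteriorAlgebra K V)
    (hVolW : VolW ∈ wedgeSpan K W (finrank K ↥W)) (hVolW0 : VolW ≠ 0)
    (VolV : ExteriorAlgebra K V)
    (hVolV : VolV ∈ wedgeSpan K (⊤ : Submodule K V) (finrank K V)) (hVolV0 : VolV ≠ 0)
    (k : ℕ)
    (c : ExteriorAlgebra K (Module.Dual K V) →ₗ[K] ExteriorAlgebra K V)
    (hc : ∀ α ∈ wedgeSpan K (⊤ : Submodule K (Module.Dual K V)) (k + finrank K ↥U),
      c α ∈ wedgeSpanZ K (⊤ : Submodule K V)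
          ((finrank K V : ℤ) - (k + finrank K ↥U : ℕ)) ∧
        ∀ β ∈ wedgeSpanZ K (⊤ : Submodule K (Module.Dual K V))
            ((finrank K V : ℤ) - (k + finrank K ↥U : ℕ)),
          P β (c α) = P ((α * β : ExteriorAlgebra K (Module.Dual K V))) VolV) :
    Set.BijOn (⇑c)
      (↑(Submodule.map (LinearMap.mulRight K VolU) (wedgeSpan K W.dualAnnihilator k)))
      (↑(Submodule.map (LinearMap.mulRight K VolW)
          (wedgeSpanZ K U.dualCoannihilator
            ((finrank K V : ℤ) - (k : ℤ) - (finrank K ↥U : ℕ) - (finrank K ↥W : ℕ))))) := by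
  classical
  have hWX : W ≤ U.dualCoannihilator := fun w hw =>
    (Submodule.mem_dualCoannihilator w).2 fun u hu => horth u hu w hw
  obtain ⟨s, _, b, A, D, hAD, hA, hD⟩ := exists_basis_adapted hWX
  have hU : U = Submodule.span K (b.dualBasis '' (Dᶜ : Finset s)) := by
    rw [← dualAnnihilator_span_image, ← hD, Subspace.dualCoannihilator_dualAnnihilator_eq]
  have hW' : W.dualAnnihilator = Submodule.span K (b.dualBasis '' (Aᶜ : Finset s)) := by
    rw [hA, dualAnnihilator_span_image]
  have hfW : finrank K W = A.card := by rw [hA, finrank_span_basis_image]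
  have hfU : finrank K U = Dᶜ.card := by rw [hU, finrank_span_basis_image]
  have hfV : finrank K V = Fintype.card s := finrank_eq_card_basis b
  rw [hfU, hfV] at hc
  rw [hfV] at hVolV
  rw [hfW, hA] at hVolW
  rw [hfU, hU] at hVolU
  rw [hfU, hfV, hfW, hW', ← hD.symm]
  obtain ⟨hcI, hinj⟩ := contraction_finsetWedge b P hP hVolV hVolV0 _ c hc
  rw [map_mulRight_wedgeSpan b.dualBasis _ _ k hVolU hVolU0 (Finset.compl_subset_compl.2 hAD)]
  have htarget : (wedgeSpanZ K (Submodule.span K (b '' D))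
      ((Fintype.card s : ℤ) - (k : ℤ) - (Dᶜ.card : ℕ) - (A.card : ℕ))).map
        (LinearMap.mulRight K VolW) = Submodule.span K {x | ∃ I : Finset s, Dᶜ ⊆ I ∧ I ⊆ Aᶜ ∧
          I.card = k + Dᶜ.card ∧ x = finsetWedge K b Iᶜ} := by
    rw [wedgeSpanZ]
    split_ifs with hz
    · rw [map_mulRight_wedgeSpan b _ _ _ hVolW hVolW0 hAD]
      congr 1
      ext x
      constructor
      · rintro ⟨J, h₁, h₂, h₃, rfl⟩
        refine ⟨Jᶜ, Finset.compl_subset_compl.2 h₂, Finset.compl_subset_compl.2 h₁, ?_,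
          by rw [compl_compl]⟩
        have := Finset.card_add_card_compl J
        omega
      · rintro ⟨I, h₁, h₂, h₃, rfl⟩
        refine ⟨Iᶜ, le_compl_comm.1 h₂, compl_le_iff_compl_le.1 h₁, ?_, rfl⟩
        have := Finset.card_add_card_compl I
        omega
    · rw [Submodule.map_bot, eq_comm, Submodule.span_eq_bot]
      rintro x ⟨I, h₁, h₂, h₃, rfl⟩
      have := Finset.card_le_card h₂
      have := Finset.card_add_card_compl A
      omega
  rw [htarget]
  have hmap : (Submodule.span K {x | ∃ I : Finset s, Dᶜ ⊆ I ∧ I ⊆ Aᶜ ∧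
      I.card = k + Dᶜ.card ∧ x = finsetWedge K b.dualBasis I}).map c =
      Submodule.span K {x | ∃ I : Finset s, Dᶜ ⊆ I ∧ I ⊆ Aᶜ ∧
          I.card = k + Dᶜ.card ∧ x = finsetWedge K b Iᶜ} := by
    rw [Submodule.map_span]
    apply le_antisymm
    · refine span_le_span_of_smul ?_
      rintro _ ⟨_, ⟨I, h₁, h₂, h₃, rfl⟩, rfl⟩
      obtain ⟨t, -, ht⟩ := hcI I h₃
      exact Or.inr ⟨t, _, ⟨I, h₁, h₂, h₃, rfl⟩, ht⟩
    · refine span_le_span_of_smul ?_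
      rintro _ ⟨I, h₁, h₂, h₃, rfl⟩
      obtain ⟨t, ht0, ht⟩ := hcI I h₃
      exact Or.inr ⟨t⁻¹, _, ⟨_, ⟨I, h₁, h₂, h₃, rfl⟩, rfl⟩, by rw [ht, inv_smul_smul₀ ht0]⟩
  rw [← hmap, Submodule.map_coe]
  refine (hinj.mono (SetLike.coe_subset_coe.2 (Submodule.span_le.2 ?_))).bijOn_image
  rintro _ ⟨I, -, -, h₃, rfl⟩
  rw [wedgeSpan_top_eq_span b.dualBasis]
  exact Submodule.subset_span ⟨I, by simp [Finset.mem_powersetCard, h₃], rfl⟩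
end

section
/- Combinatorial stalk duality (the stalk-level content of Theorem 5.3): Let M = ℤ^d and let N be its dual lattice with the canonical pairing ⟨·,·⟩ : M × N → ℤ. Let S₁ ⊆ M and S₂ ⊆ N be finite ℚ-linearly independent subsets with ⟨s,t⟩ = 0 for all s ∈ S₁ and t ∈ S₂. Set δ₁ = card S₁, δ₂ = card S₂ and n = d − δ₁ − δ₂ (which is a nonnegative integer since the span of S₂ lies in the annihilator of the span of S₁). Then for all λ, μ ∈ ℚ: the sum, over all triples (g,h,a) with g ∈ Box(S₁), h ∈ Box(S₂), a ∈ ℕ satisfying a − age(g) + age(h) = λ and age(g) + age(h) = μ, of the binomial coefficient binom(n, a−δ₂), equals the sum, over all triples (g,h,a) with g ∈ Box(S₂), h ∈ Box(S₁), a ∈ ℕ satisfying a − age(g) + age(h) = d − λ and age(g) + age(h) = μ, of binom(n, a−δ₁). Here binom(n,j) is taken to be 0 when j < 0 or j > n, and all the sums are finite. -/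
/-- The set of coefficient vectors of elements of the box `Box(S)` of a finite set
`S ⊆ ℤ^d`: families `a : S → ℝ` with `a_s ∈ [0,1)` such that `Σ_{s∈S} a_s·s` is a lattice
point.  When `S` is ℚ-linearly independent these are in bijection with the elements of
`Box(S)`, and the age of the corresponding box element is `Σ_s a_s`. -/
def BoxCoeffs {d : ℕ} (S : Finset (Fin d → ℤ)) : Set (↥S → ℝ) :=
  {a | (∀ s, a s ∈ Set.Ico (0 : ℝ) 1) ∧
    ∃ x : Fin d → ℤ, ∀ i, (x i : ℝ) = ∑ s, a s * ((s : Fin d → ℤ) i : ℝ)}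

/-- The elements of a finite set of lattice vectors, as the rows of a rational matrix. -/
def latticeMatrix {d : ℕ} (S : Finset (Fin d → ℤ)) : Matrix S (Fin d) ℚ :=
  Matrix.of fun s i => ((s : Fin d → ℤ) i : ℚ)

lemma rank_latticeMatrix {d : ℕ} {S : Finset (Fin d → ℤ)}
    (hS : LinearIndependent ℚ (fun (s : ↥S) (i : Fin d) => ((s : Fin d → ℤ) i : ℚ))) :
    (latticeMatrix S).rank = S.card := by
  have h : LinearIndependent ℚ (latticeMatrix S).row := hS
  simpa using h.rank_matrix

lemma card_add_card_le_of_orthogonal {d : ℕ} {S T : Finset (Fin d → ℤ)}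
    (hS : LinearIndependent ℚ (fun (s : ↥S) (i : Fin d) => ((s : Fin d → ℤ) i : ℚ)))
    (hT : LinearIndependent ℚ (fun (t : ↥T) (i : Fin d) => ((t : Fin d → ℤ) i : ℚ)))
    (horth : ∀ s ∈ S, ∀ t ∈ T, (∑ i, s i * t i) = 0) :
    S.card + T.card ≤ d := by
  have hmul : latticeMatrix S * (latticeMatrix T).transpose = 0 := by
    ext s t
    simpa [Matrix.mul_apply, latticeMatrix] using
      congrArg (Int.cast : ℤ → ℚ) (horth s s.2 t t.2)
  simpa [Matrix.rank_transpose, rank_latticeMatrix hS, rank_latticeMatrix hT] using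
    Matrix.rank_add_rank_le_card_of_mul_eq_zero hmul

/-- Rationally independent lattice vectors admit a rational matrix which recovers the
coefficients of any real combination of them. -/
lemma exists_coeff_eq_sum_mul {d : ℕ} {S : Finset (Fin d → ℤ)}
    (hS : LinearIndependent ℚ (fun (s : ↥S) (i : Fin d) => ((s : Fin d → ℤ) i : ℚ))) :
    ∃ B : Fin d → S → ℝ, ∀ (a : S → ℝ) (t : S),
      a t = ∑ i, (∑ s, a s * ((s : Fin d → ℤ) i : ℝ)) * B i t := by
  have hsurj : Function.Surjective (latticeMatrix S).mulVec := by
    have htop : LinearMap.range (latticeMatrix S).mulVecLin = ⊤ := by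
      apply Submodule.eq_top_of_finrank_eq
      rw [Module.finrank_fintype_fun_eq_card, Fintype.card_coe]
      exact rank_latticeMatrix hS
    exact LinearMap.range_eq_top.mp htop
  obtain ⟨B, hB⟩ := Matrix.mulVec_surjective_iff_exists_right_inverse.mp hsurj
  refine ⟨fun i t => (B i t : ℝ), fun a t => ?_⟩
  have hentry (s : S) :
      ∑ i, ((s : Fin d → ℤ) i : ℝ) * (B i t : ℝ) = if s = t then 1 else 0 := by
    have h := congrArg (Rat.cast : ℚ → ℝ) (congrFun (congrFun hB s) t)
    simpa [Matrix.mul_apply, latticeMatrix, Matrix.one_apply, apply_ite] using h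
  simp_rw [Finset.sum_mul]
  rw [Finset.sum_comm]
  simp_rw [mul_assoc, ← Finset.mul_sum, hentry]
  simp

lemma finite_boxCoeffs {d : ℕ} {S : Finset (Fin d → ℤ)}
    (hS : LinearIndependent ℚ (fun (s : ↥S) (i : Fin d) => ((s : Fin d → ℤ) i : ℚ))) :
    (BoxCoeffs S).Finite := by
  obtain ⟨B, hB⟩ := exists_coeff_eq_sum_mul hS
  let b : Fin d → ℤ := fun i => ∑ s : S, |(s : Fin d → ℤ) i|
  refine ((Set.finite_Icc (-b) b).image
    fun x t => ∑ i, (x i : ℝ) * B i t).subset ?_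
  rintro a ⟨ha, x, hx⟩
  refine ⟨x, ?_, ?_⟩
  · have hbound (i : Fin d) : |x i| ≤ b i := by
      have h : |(x i : ℝ)| ≤ (b i : ℝ) := by
        rw [hx i]
        push_cast [b]
        refine (Finset.abs_sum_le_sum_abs _ _).trans (Finset.sum_le_sum fun s _ => ?_)
        rw [abs_mul, abs_of_nonneg (ha s).1]
        exact mul_le_of_le_one_left (abs_nonneg _) (ha s).2.le
      exact_mod_cast h
    exact ⟨fun i => (abs_le.mp (hbound i)).1, fun i => (abs_le.mp (hbound i)).2⟩
  · ext t
    simp only [hx]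
    exact (hB a t).symm

/-- The substitution `a ↦ d - a` in the sum over `a`, for a fixed pair of box elements of
ages `u` and `v`. -/
lemma finsum_choose_reflect {d m n : ℕ} (hmn : m + n ≤ d) (u v lam mu : ℝ) :
    (∑ᶠ (a : ℕ), ∑ᶠ (_ : (a : ℝ) - u + v = lam ∧ u + v = mu ∧ n ≤ a),
      (d - m - n).choose (a - n)) =
    ∑ᶠ (a : ℕ), ∑ᶠ (_ : (a : ℝ) - v + u = d - lam ∧ v + u = mu ∧ m ≤ a),
      (d - m - n).choose (a - m) := by
  classical
  have hsupp (k : ℕ) (hk : k + (d - m - n) ≤ d) (P : ℕ → Prop) (hP : ∀ a, P a → k ≤ a) :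
      Function.support (fun a => ∑ᶠ (_ : P a), (d - m - n).choose (a - k)) ⊆
        (Finset.range (d + 1) : Set ℕ) := by
    intro a ha
    by_contra hmem
    apply ha
    have hlt : d < a := by simpa using hmem
    simp only [Nat.choose_eq_zero_of_lt (show d - m - n < a - k by omega), finsum_zero]
  rw [finsum_eq_sum_of_support_subset _ (hsupp n (by omega) _ fun a ha => ha.2.2),
    finsum_eq_sum_of_support_subset _ (hsupp m (by omega) _ fun a ha => ha.2.2),
    ← Finset.sum_range_reflect]
  refine Finset.sum_congr rfl fun a ha => ?_
  have had : a ≤ d := by simpa [Nat.lt_succ_iff] using ha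
  simp only [finsum_eq_if, Nat.add_sub_cancel, Nat.cast_sub had]
  by_cases hma : m ≤ a
  · by_cases hna : n ≤ d - a
    · have hchoose : (d - m - n).choose (d - a - n) = (d - m - n).choose (a - m) :=
        Nat.choose_symm_of_eq_add (by omega)
      have hiff : ((d : ℝ) - a - u + v = lam ∧ u + v = mu ∧ n ≤ d - a) ↔
          ((a : ℝ) - v + u = d - lam ∧ v + u = mu ∧ m ≤ a) := by
        constructor <;> rintro ⟨h1, h2, -⟩ <;> exact ⟨by linarith, by linarith, by assumption⟩
      simp only [hiff, hchoose]
    · rw [if_neg fun h => hna h.2.2, Nat.choose_eq_zero_of_lt (by omega), ite_self]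
  · rw [if_neg fun h : _ ∧ _ ∧ m ≤ a => hma h.2.2,
      Nat.choose_eq_zero_of_lt (by omega), ite_self]

/-- **Combinatorial stalk duality** (the stalk-level content of Theorem 5.3): for finite
ℚ-linearly independent `S₁ ⊆ M = ℤ^d`, `S₂ ⊆ N` pairing to zero, with `δᵢ = |Sᵢ|` and
`n = d − δ₁ − δ₂`, for all `λ, μ ∈ ℚ` the sum over triples `(g,h,a)`,
`g ∈ Box(S₁)`, `h ∈ Box(S₂)`, `a ∈ ℕ` with `a − age(g) + age(h) = λ` and
`age(g) + age(h) = μ`, of `C(n, a−δ₂)` equals the corresponding sum with `S₁, S₂`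
interchanged and `λ` replaced by `d − λ` and `C(n, a−δ₂)` by `C(n, a−δ₁)` (binomial
coefficients vanish outside `0 ≤ a−δ ≤ n`; all sums are finite). -/
theorem stmt3 {d : ℕ} (S₁ S₂ : Finset (Fin d → ℤ))
    (h₁ : LinearIndependent ℚ (fun (s : ↥S₁) (i : Fin d) => ((s : Fin d → ℤ) i : ℚ)))
    (h₂ : LinearIndependent ℚ (fun (t : ↥S₂) (i : Fin d) => ((t : Fin d → ℤ) i : ℚ)))
    (horth : ∀ s ∈ S₁, ∀ t ∈ S₂, (∑ i, s i * t i) = 0)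
    (lam mu : ℚ) :
    (∑ᶠ g ∈ BoxCoeffs S₁, ∑ᶠ h ∈ BoxCoeffs S₂, ∑ᶠ (a : ℕ),
      ∑ᶠ (_ : (a : ℝ) - (∑ s, g s) + (∑ t, h t) = (lam : ℝ) ∧
            (∑ s, g s) + (∑ t, h t) = (mu : ℝ) ∧ S₂.card ≤ a),
        (d - S₁.card - S₂.card).choose (a - S₂.card)) =
    (∑ᶠ g ∈ BoxCoeffs S₂, ∑ᶠ h ∈ BoxCoeffs S₁, ∑ᶠ (a : ℕ),
      ∑ᶠ (_ : (a : ℝ) - (∑ t, g t) + (∑ s, h s) = (d : ℝ) - (lam : ℝ) ∧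
            (∑ t, g t) + (∑ s, h s) = (mu : ℝ) ∧ S₁.card ≤ a),
        (d - S₁.card - S₂.card).choose (a - S₁.card)) := by
  rw [finsum_mem_comm _ (finite_boxCoeffs h₁) (finite_boxCoeffs h₂)]
  have hcard := card_add_card_le_of_orthogonal h₁ h₂ horth
  simp only [finsum_choose_reflect hcard]
end

section
/- Lower convex hull description of a coherent star triangulation (key step of Proposition 4.4): Let A ⊆ ℝ^d be a finite set, P = convexHull(A), and let φ : ℝ^d → ℝ be a function that is convex on P and such that for every q ∈ P there exist a subset B ⊆ A and an affine map ℓ : ℝ^d → ℝ with q ∈ convexHull(B) and φ(y) = ℓ(y) for all y ∈ convexHull(B). Let Ã = {(a, φ(a)) : a ∈ A} ⊆ ℝ^d × ℝ. Then for every q ∈ P: (i) (q, φ(q)) ∈ convexHull(Ã), and (ii) every point (q, x) ∈ convexHull(Ã) satisfies x ≥ φ(q). In particular φ(q) = min{x ∈ ℝ : (q,x) ∈ convexHull(Ã)}, i.e. the lower convex hull of Ã is exactly the graph of φ over P. -/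
/-- **Lower convex hull description of a coherent star triangulation** (key step of
Proposition 4.4): let `A ⊆ ℝ^d` be finite, `P = conv(A)`, and `φ` convex on `P` and piecewise
affine with respect to convex hulls of subsets of `A`.  Let `Ã = {(a, φ(a)) : a ∈ A}`.  Then for
every `q ∈ P`: (i) `(q, φ(q)) ∈ conv(Ã)`; (ii) every `(q, x) ∈ conv(Ã)` has `x ≥ φ(q)`; hence
`φ(q) = min {x : (q,x) ∈ conv(Ã)}`, i.e. the lower convex hull of `Ã` is the graph of `φ`. -/
theorem stmt4 {d : ℕ} (A : Set (Fin d → ℝ)) (hA : A.Finite)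
    (φ : (Fin d → ℝ) → ℝ)
    (hconv : ConvexOn ℝ (convexHull ℝ A) φ)
    (hpl : ∀ q ∈ convexHull ℝ A, ∃ B : Set (Fin d → ℝ), B ⊆ A ∧
      ∃ ℓ : (Fin d → ℝ) →ᵃ[ℝ] ℝ, q ∈ convexHull ℝ B ∧ ∀ y ∈ convexHull ℝ B, φ y = ℓ y) :
    ∀ q ∈ convexHull ℝ A,
      (q, φ q) ∈ convexHull ℝ ((fun a => (a, φ a)) '' A) ∧
      (∀ x : ℝ, (q, x) ∈ convexHull ℝ ((fun a => (a, φ a)) '' A) → φ q ≤ x) ∧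
      IsLeast {x : ℝ | (q, x) ∈ convexHull ℝ ((fun a => (a, φ a)) '' A)} (φ q) := by
  intro q hq
  have mem_graph : (q, φ q) ∈ convexHull ℝ ((fun a => (a, φ a)) '' A) := by
    obtain ⟨B, hBA, ℓ, hqB, hφℓ⟩ := hpl q hq
    have hmem := Set.mem_image_of_mem ((AffineMap.id ℝ (Fin d → ℝ)).prod ℓ) hqB
    rw [AffineMap.image_convexHull] at hmem
    rw [hφℓ q hqB]
    refine convexHull_mono ?_ hmem
    rintro _ ⟨b, hb, rfl⟩
    exact ⟨b, hBA hb, Prod.ext rfl (hφℓ b (subset_convexHull ℝ B hb))⟩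
  have le_of_mem : ∀ x : ℝ, (q, x) ∈ convexHull ℝ ((fun a => (a, φ a)) '' A) → φ q ≤ x := by
    intro x hx
    refine (convexHull_min ?_ hconv.convex_epigraph hx).2
    rintro _ ⟨a, ha, rfl⟩
    exact ⟨subset_convexHull ℝ A ha, le_rfl⟩
  exact ⟨mem_graph, le_of_mem, mem_graph, le_of_mem⟩
end

section
/- Cayley polytope description (key step in the proof of Proposition 6.6): Let ρ₁,…,ρ_s ∈ ℝ^d be linearly independent and let φ₁,…,φ_{k+1} : ℝ^d → ℝ be linear maps satisfying Σ_{i=1}^{k+1} φᵢ(ρⱼ) = 1 for every j = 1,…,s. In ℝ^d × ℝ^k, let e₁,…,e_k denote the standard basis of the ℝ^k factor, and consider the finite set F = {(ρⱼ, φ₁(ρⱼ), …, φ_k(ρⱼ)) : 1 ≤ j ≤ s} ∪ {(0, eᵢ) : 1 ≤ i ≤ k} ∪ {(0,0)}. Then convexHull(F) equals the set of points (m, x₁,…,x_k) ∈ ℝ^d × ℝ^k such that: m = Σⱼ yⱼρⱼ for some yⱼ ≥ 0; xᵢ ≥ φᵢ(m) for every i = 1,…,k; and Σ_{i=1}^{k+1}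 φᵢ(m) + Σ_{i=1}^{k} (xᵢ − φᵢ(m)) ≤ 1. -/
/-- A convex set containing the origin is closed under finite combinations whose nonnegative
weights sum to at most one. -/
theorem Convex.sum_mem_of_zero_mem {ι E : Type*} [Fintype ι] [AddCommGroup E] [Module ℝ E]
    {S : Set E} (hS : Convex ℝ S) (h0 : (0 : E) ∈ S) {w : ι → ℝ} {z : ι → E}
    (hw : ∀ i, 0 ≤ w i) (hw1 : ∑ i, w i ≤ 1) (hz : ∀ i, z i ∈ S) :
    ∑ i, w i • z i ∈ S := by
  have h := hS.sum_mem (t := Finset.univ) (w := fun o : Option ι => o.elim (1 - ∑ i, w i) w)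
    (z := fun o => o.elim 0 z)
    (by rintro (_ | i) - <;> simp [hw, hw1])
    (by simp [Fintype.sum_option])
    (by rintro (_ | i) - <;> simp [hz, h0])
  simpa [Fintype.sum_option] using h


/-- **Cayley polytope description** (key step in the proof of Proposition 6.6): let
`ρ₁,…,ρ_s ∈ ℝ^d` be linearly independent and `φ₁,…,φ_{k+1}` linear maps with
`Σᵢ φᵢ(ρⱼ) = 1` for every `j`.  Then in `ℝ^d × ℝ^k` the convex hull of
`{(ρⱼ, φ₁(ρⱼ),…,φ_k(ρⱼ))} ∪ {(0,eᵢ)} ∪ {(0,0)}` is the set of points `(m, x₁,…,x_k)` with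
`m = Σⱼ yⱼρⱼ`, `yⱼ ≥ 0`, `xᵢ ≥ φᵢ(m)` for `i ≤ k`, and
`Σ_{i=1}^{k+1} φᵢ(m) + Σ_{i=1}^{k} (xᵢ − φᵢ(m)) ≤ 1`. -/
theorem stmt9 {d k s : ℕ} (ρ : Fin s → (Fin d → ℝ)) (hρ : LinearIndependent ℝ ρ)
    (φ : Fin (k + 1) → ((Fin d → ℝ) →ₗ[ℝ] ℝ))
    (hφ : ∀ j, (∑ i, φ i (ρ j)) = 1) :
    convexHull ℝ
      ((Set.range fun j : Fin s =>
          ((ρ j, fun i : Fin k => φ i.castSucc (ρ j)) : (Fin d → ℝ) × (Fin k → ℝ))) ∪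
        (Set.range fun i : Fin k =>
          ((0, Pi.single i 1) : (Fin d → ℝ) × (Fin k → ℝ))) ∪
        {((0, 0) : (Fin d → ℝ) × (Fin k → ℝ))}) =
      {p : (Fin d → ℝ) × (Fin k → ℝ) |
        (∃ y : Fin s → ℝ, (∀ j, 0 ≤ y j) ∧ p.1 = ∑ j, y j • ρ j) ∧
        (∀ i : Fin k, φ i.castSucc p.1 ≤ p.2 i) ∧
        (∑ i, φ i p.1) + (∑ i : Fin k, (p.2 i - φ i.castSucc p.1)) ≤ 1} := by
  apply Set.Subset.antisymm
  · apply convexHull_min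
    · rintro p ((⟨j, rfl⟩ | ⟨i, rfl⟩) | rfl)
      · refine ⟨⟨Pi.single j 1, fun l => ?_, ?_⟩, fun i => le_rfl, ?_⟩
        · by_cases h : l = j <;> simp [h]
        · simp [Pi.single_apply]
        · simp [hφ]
      · refine ⟨⟨0, by simp, by simp⟩, fun l => ?_, by simp⟩
        by_cases h : l = i <;> simp [h]
      · exact ⟨⟨0, by simp, by simp⟩, by simp, by simp⟩
    · rintro p ⟨⟨y, hy, hpy⟩, hp, hp1⟩ q ⟨⟨z, hz, hqz⟩, hq, hq1⟩ a b ha hb hab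
      refine ⟨⟨a • y + b • z, fun j => ?_, ?_⟩, fun i => ?_, ?_⟩
      · exact add_nonneg (mul_nonneg ha (hy j)) (mul_nonneg hb (hz j))
      · simp [hpy, hqz, add_smul, mul_smul, Finset.sum_add_distrib, Finset.smul_sum]
      · simpa using add_le_add (mul_le_mul_of_nonneg_left (hp i) ha)
          (mul_le_mul_of_nonneg_left (hq i) hb)
      · have h := add_le_add (mul_le_mul_of_nonneg_left hp1 ha)
          (mul_le_mul_of_nonneg_left hq1 hb)
        simp only [Finset.sum_sub_distrib] at h
        simp only [Prod.fst_add, Prod.snd_add, Prod.smul_fst, Prod.smul_snd, map_add, map_smul,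
          Pi.add_apply, Pi.smul_apply, smul_eq_mul, Finset.sum_add_distrib,
          Finset.sum_sub_distrib, ← Finset.mul_sum]
        linarith
  · rintro ⟨m, x⟩ ⟨⟨y, hy, rfl⟩, hx, hx1⟩
    have hsum : ∑ i, φ i (∑ j, y j • ρ j) = ∑ j, y j := by
      simp only [map_sum, map_smul, smul_eq_mul]
      rw [Finset.sum_comm]
      simp [← Finset.mul_sum, hφ]
    simp only [hsum] at hx hx1
    have h := (convex_convexHull ℝ _).sum_mem_of_zero_mem
      (subset_convexHull ℝ
        ((Set.range fun j : Fin s =>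
            ((ρ j, fun i : Fin k => φ i.castSucc (ρ j)) : (Fin d → ℝ) × (Fin k → ℝ))) ∪
          (Set.range fun i : Fin k =>
            ((0, Pi.single i 1) : (Fin d → ℝ) × (Fin k → ℝ))) ∪
          {((0, 0) : (Fin d → ℝ) × (Fin k → ℝ))}) (Or.inr rfl))
      (w := Sum.elim y fun i => x i - φ i.castSucc (∑ j, y j • ρ j))
      (z := Sum.elim (fun j => (ρ j, fun i => φ i.castSucc (ρ j)))
        fun i => (0, Pi.single i 1))
      (by rintro (j | i) <;> simp only [Sum.elim_inl, Sum.elim_inr, sub_nonneg, hy, hx])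
      (by simpa only [Fintype.sum_sum_type, Sum.elim_inl, Sum.elim_inr] using hx1)
      (by
        rintro (j | i)
        · exact subset_convexHull ℝ _ (Or.inl (Or.inl ⟨j, rfl⟩))
        · exact subset_convexHull ℝ _ (Or.inl (Or.inr ⟨i, rfl⟩)))
    convert h using 1
    ext l
    · simp [Prod.fst_sum]
    · simp [Prod.snd_sum, Finset.sum_apply, Pi.single_apply]
end
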